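/- arXiv:2601.10894 — 10 statements merged into one kernel-verified Lean document; each statement's English description precedes it below -/
import Mathlib

section
/- Let u be a real number with 0 < u ≤ 1/2 and set z = u/((1+u)(1+4u)). Then 1 - 10z + 9z² = (1 - 4u²)²/((1+u)²(1+4u)²), and consequently S(z) = (1 - z - √(1 - 10z + 9z²))/(4z) equals 1 + 2u. -/
/-- Under the substitution `z = u/((1+u)(1+4u))` with `0 < u ≤ 1/2`, the discriminant
`1 - 10z + 9z²` equals `(1 - 4u²)²/((1+u)²(1+4u)²)`, and consequently
`S(z) = (1 - z - √(1 - 10z + 9z²))/(4z) = 1 + 2u`. -/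
theorem skew_dyck_gf_substitution (u : ℝ) (hu0 : 0 < u) (hu1 : u ≤ 1 / 2)
    (z : ℝ) (hz : z = u / ((1 + u) * (1 + 4 * u))) :
    1 - 10 * z + 9 * z ^ 2 = (1 - 4 * u ^ 2) ^ 2 / ((1 + u) ^ 2 * (1 + 4 * u) ^ 2) ∧
    (1 - z - Real.sqrt (1 - 10 * z + 9 * z ^ 2)) / (4 * z) = 1 + 2 * u := by
  have h₁ : 1 + u ≠ 0 := by positivity
  have h₂ : 1 + 4 * u ≠ 0 := by positivity
  have hdisc : 1 - 10 * z + 9 * z ^ 2 =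
      (1 - 4 * u ^ 2) ^ 2 / ((1 + u) ^ 2 * (1 + 4 * u) ^ 2) := by
    rw [hz]
    field_simp
    ring
  refine ⟨hdisc, ?_⟩
  have hnum : 0 ≤ 1 - 4 * u ^ 2 := by nlinarith
  rw [hdisc, ← mul_pow, ← div_pow, Real.sqrt_sq (by positivity), hz]
  field_simp
  ring
end

section
/- Define the integer sequence a : ℕ → ℕ by a(0) = 1, a(1) = 2, and for n ≥ 2, a(n) = 2·Σ_{k=0}^{n-1} a(k)·a(n-1-k) + a(n-1). Then for every n ≥ 1, a(n) equals the coefficient of X^n in the polynomial (1 + 2X - 4X² - 8X³)·(1+X)^{n-1}·(1+4X)^{n-1}; equivalently, a(n) = B(n,n) + 2·B(n,n-1) - 4·B(n,n-2) - 8·B(n,n-3), where B(n,k) = Σ_{j=0}^{k} 4^j · C(n-1,j) · C(n-1,k-j) (with B(n,k) = 0 for k < 0). -/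
open Polynomial

section Lagrange

variable {R : Type*} [CommRing R] [NoZeroDivisors R] [CharZero R]

theorem PowerSeries.coeff_succ_pow_mul_sub_X_mul_derivative (φ : PowerSeries R) (m : ℕ) :
    PowerSeries.coeff (m + 1)
      (φ ^ m * (φ - PowerSeries.X * PowerSeries.derivative R φ)) = 0 := by
  have hm : ((m : R) + 1) ≠ 0 := by exact_mod_cast Nat.succ_ne_zero m
  refine (mul_eq_zero.mp ?_).resolve_left hm
  have hd : PowerSeries.derivative R (φ ^ (m + 1)) =
      PowerSeries.C ((m : R) + 1) * (φ ^ m * PowerSeries.derivative R φ) := by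
    rw [Derivation.leibniz_pow]
    simp
  have hc := congrArg (PowerSeries.coeff m) hd
  rw [PowerSeries.coeff_derivative, PowerSeries.coeff_C_mul] at hc
  rw [mul_sub, ← pow_succ, mul_left_comm, map_sub, PowerSeries.coeff_succ_X_mul, mul_sub, ← hc]
  ring

/-- Lagrange inversion: `f` is recovered from its composite with `X / φ`. -/
theorem PowerSeries.coeff_eq_coeff_subst_mul_pow {φ ψ : PowerSeries R} (h : φ * ψ = 1)
    (f : PowerSeries R) (n : ℕ) :
    PowerSeries.coeff (n + 1) f = PowerSeries.coeff (n + 1)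
      (f.subst (PowerSeries.X * ψ) *
        (φ ^ n * (φ - PowerSeries.X * PowerSeries.derivative R φ))) := by
  have hs : PowerSeries.HasSubst (PowerSeries.X * ψ) :=
    PowerSeries.HasSubst.of_constantCoeff_zero' (by simp)
  set D := φ - PowerSeries.X * PowerSeries.derivative R φ with hD
  have hsub : f.subst (PowerSeries.X * ψ) =
      PowerSeries.X ^ (n + 2) * (ψ ^ (n + 2) *
        (PowerSeries.mk fun i => PowerSeries.coeff (i + (n + 2)) f).subst (PowerSeries.X * ψ)) +
      ∑ k ∈ Finset.range (n + 2),
        PowerSeries.C (PowerSeries.coeff k f) * (PowerSeries.X * ψ) ^ k := by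
    conv_lhs => rw [PowerSeries.eq_X_pow_mul_shift_add_trunc (n + 2) f]
    rw [PowerSeries.subst_add hs, PowerSeries.subst_mul hs, PowerSeries.subst_pow hs,
      PowerSeries.subst_X hs, PowerSeries.subst_coe hs, mul_pow, mul_assoc]
    congr 1
    rw [Polynomial.aeval_eq_sum_range' (PowerSeries.natDegree_trunc_lt f (n + 1))]
    refine Finset.sum_congr rfl fun k hk => ?_
    rw [PowerSeries.coeff_trunc, if_pos (Finset.mem_range.mp hk), PowerSeries.smul_eq_C_mul]
  rw [hsub, add_mul, map_add, mul_assoc, PowerSeries.coeff_X_pow_mul', if_neg (by omega), zero_add,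
    Finset.sum_mul, map_sum, Finset.sum_range_succ, Finset.sum_eq_zero, zero_add]
  · have hφ : PowerSeries.constantCoeff φ * PowerSeries.constantCoeff ψ = 1 := by
      rw [← map_mul, h, map_one]
    have e : PowerSeries.C (PowerSeries.coeff (n + 1) f) * (PowerSeries.X * ψ) ^ (n + 1) *
        (φ ^ n * D) = PowerSeries.C (PowerSeries.coeff (n + 1) f) *
          (PowerSeries.X ^ (n + 1) * ((φ * ψ) ^ n * (ψ * D))) := by ring
    rw [e, h, PowerSeries.coeff_C_mul, PowerSeries.coeff_X_pow_mul', if_pos le_rfl, hD]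
    simp [mul_comm, hφ]
  · intro k hk
    obtain ⟨m, rfl⟩ := Nat.exists_eq_add_of_le (Nat.lt_succ_iff.mp (Finset.mem_range.mp hk))
    have e : PowerSeries.C (PowerSeries.coeff k f) * (PowerSeries.X * ψ) ^ k *
        (φ ^ (k + m) * D) = PowerSeries.C (PowerSeries.coeff k f) *
          (PowerSeries.X ^ k * ((φ * ψ) ^ k * (φ ^ m * D))) := by ring
    rw [e, h, PowerSeries.coeff_C_mul, PowerSeries.coeff_X_pow_mul', if_pos (by omega), one_pow,
      one_mul, show k + m + 1 - k = m + 1 by omega, hD,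
      PowerSeries.coeff_succ_pow_mul_sub_X_mul_derivative, mul_zero]

end Lagrange

/-- The functional equation of the generating function of skew Dyck paths. -/
theorem skewDyck_mk_eq {a : ℕ → ℕ} (ha0 : a 0 = 1) (ha1 : a 1 = 2)
    (harec : ∀ n : ℕ, 2 ≤ n →
      a n = 2 * ∑ k ∈ Finset.range n, a k * a (n - 1 - k) + a (n - 1)) :
    (PowerSeries.mk fun n => (a n : ℤ)) =
      1 + PowerSeries.X * (2 * (PowerSeries.mk fun n => (a n : ℤ)) ^ 2 +
        (PowerSeries.mk fun n => (a n : ℤ)) - 1) := by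
  have h2 : (2 : PowerSeries ℤ) = PowerSeries.C 2 := rfl
  ext n
  rcases n with _ | n
  · simp [ha0]
  · rw [map_add, PowerSeries.coeff_succ_X_mul, map_sub, map_add, h2, PowerSeries.coeff_C_mul, sq,
      PowerSeries.coeff_mul, Finset.Nat.sum_antidiagonal_eq_sum_range_succ_mk]
    rcases n with _ | n
    · simp [ha0, ha1, PowerSeries.coeff_one]
    · simp [PowerSeries.coeff_one, harec (n + 2) (by omega)]

theorem skewDyck_mk_subst {f ψ : PowerSeries ℤ}
    (hf : f = 1 + PowerSeries.X * (2 * f ^ 2 + f - 1))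
    (hψ : (1 + PowerSeries.X) * (1 + 4 * PowerSeries.X) * ψ = 1) :
    f.subst (PowerSeries.X * ψ) = 1 + 2 * PowerSeries.X := by
  have hs : PowerSeries.HasSubst (PowerSeries.X * ψ) :=
    PowerSeries.HasSubst.of_constantCoeff_zero' (by simp)
  have hT := congrArg (PowerSeries.substAlgHom (R := ℤ) hs) hf
  simp only [map_add, map_mul, map_sub, map_pow, map_one, map_ofNat,
    PowerSeries.substAlgHom_X] at hT
  rw [← PowerSeries.coe_substAlgHom hs]
  set T := PowerSeries.substAlgHom (R := ℤ) hs f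
  have hprod : (T - (1 + 2 * PowerSeries.X)) *
      (1 - PowerSeries.X * ψ * (2 * (T + (1 + 2 * PowerSeries.X)) + 1)) = 0 := by
    linear_combination hT + 2 * PowerSeries.X * hψ
  refine sub_eq_zero.mp ((mul_eq_zero.mp hprod).resolve_right fun h0 => ?_)
  simpa using congrArg PowerSeries.constantCoeff h0

theorem Polynomial.coeff_one_add_X_pow_mul_one_add_four_mul_X_pow (m k : ℕ) :
    ((1 + X) ^ m * (1 + 4 * X) ^ m : ℤ[X]).coeff k =
      ∑ j ∈ Finset.range (k + 1), (4 : ℤ) ^ j * m.choose j * m.choose (k - j) := by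
  have h : ((1 + 4 * X) ^ m : ℤ[X]) = ((1 + X) ^ m).comp (C 4 * X) := by simp
  rw [mul_comm, Polynomial.coeff_mul, Finset.Nat.sum_antidiagonal_eq_sum_range_succ_mk]
  refine Finset.sum_congr rfl fun j _ => ?_
  rw [h, Polynomial.comp_C_mul_X_coeff, Polynomial.coeff_one_add_X_pow,
    Polynomial.coeff_one_add_X_pow, mul_comm ((m.choose j : ℕ) : ℤ)]


/-- The number `a(n)` of skew Dyck paths with two variants of down-steps of semilength `n`,
defined by the convolution recurrence `a(0) = 1`, `a(1) = 2`,
`a(n) = 2 Σ_{k=0}^{n-1} a(k) a(n-1-k) + a(n-1)` for `n ≥ 2`, equals, for `n ≥ 1`,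
the coefficient of `X^n` in `(1 + 2X - 4X² - 8X³)(1+X)^{n-1}(1+4X)^{n-1}`; equivalently,
`a(n) = B(n,n) + 2 B(n,n-1) - 4 B(n,n-2) - 8 B(n,n-3)` where
`B(n,k) = Σ_{j=0}^{k} 4^j C(n-1,j) C(n-1,k-j)` (and `B(n,k) = 0` for `k < 0`). -/
theorem skew_dyck_count_trinomial (a : ℕ → ℕ)
    (ha0 : a 0 = 1) (ha1 : a 1 = 2)
    (harec : ∀ n : ℕ, 2 ≤ n →
      a n = 2 * ∑ k ∈ Finset.range n, a k * a (n - 1 - k) + a (n - 1))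
    (B : ℕ → ℤ → ℤ)
    (hB : ∀ (n : ℕ) (k : ℤ), B n k =
      if k < 0 then 0
      else ∑ j ∈ Finset.range (k.toNat + 1),
        (4 : ℤ) ^ j * ((n - 1).choose j) * ((n - 1).choose (k.toNat - j))) :
    ∀ n : ℕ, 1 ≤ n →
      ((a n : ℤ) =
        (((1 + 2 * X - 4 * X ^ 2 - 8 * X ^ 3) * (1 + X) ^ (n - 1) * (1 + 4 * X) ^ (n - 1) :
          Polynomial ℤ)).coeff n) ∧
      ((a n : ℤ) =
        B n (n : ℤ) + 2 * B n ((n : ℤ) - 1) - 4 * B n ((n : ℤ) - 2) - 8 * B n ((n : ℤ) - 3)) := by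
  intro n hn
  have hcoeff : (a n : ℤ) =
      (((1 + 2 * X - 4 * X ^ 2 - 8 * X ^ 3) * (1 + X) ^ (n - 1) * (1 + 4 * X) ^ (n - 1) :
        Polynomial ℤ)).coeff n := by
    obtain ⟨m, rfl⟩ := Nat.exists_eq_add_of_le' hn
    let φ : PowerSeries ℤ := (1 + PowerSeries.X) * (1 + 4 * PowerSeries.X)
    have hφ : φ * PowerSeries.invOfUnit φ 1 = 1 :=
      PowerSeries.mul_invOfUnit φ 1 (by simp [φ])
    have hL := PowerSeries.coeff_eq_coeff_subst_mul_pow hφ (PowerSeries.mk fun n => (a n : ℤ)) m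
    rw [skewDyck_mk_subst (skewDyck_mk_eq ha0 ha1 harec) hφ, PowerSeries.coeff_mk] at hL
    have hd : PowerSeries.derivative ℤ φ = 5 + 8 * PowerSeries.X := by
      have h4 : (4 : PowerSeries ℤ) = PowerSeries.C 4 := rfl
      simp only [φ, Derivation.leibniz, map_add, h4, PowerSeries.derivative_C,
        PowerSeries.derivative_X, PowerSeries.derivative_one, smul_eq_mul]
      rw [← h4]
      ring
    rw [hL, hd, ← Polynomial.coeff_coe]
    congr 1
    have hc (k : ℕ) [k.AtLeastTwo] :
        ((OfNat.ofNat k : ℤ[X]) : PowerSeries ℤ) = OfNat.ofNat k :=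
      map_ofNat Polynomial.coeToPowerSeries.ringHom k
    simp only [φ, Polynomial.coe_add, Polynomial.coe_sub, Polynomial.coe_mul, Polynomial.coe_pow,
      Polynomial.coe_one, Polynomial.coe_X, hc, Nat.add_sub_cancel, mul_pow]
    ring
  refine ⟨hcoeff, ?_⟩
  rw [hcoeff]
  set P : ℤ[X] := (1 + X) ^ (n - 1) * (1 + 4 * X) ^ (n - 1) with hP
  have hBP (k : ℕ) : B n ((n : ℤ) - k) = (P * X ^ k).coeff n := by
    rw [hB, Polynomial.coeff_mul_X_pow']
    by_cases hkn : k ≤ n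
    · rw [if_neg (by omega), if_pos hkn, hP,
        Polynomial.coeff_one_add_X_pow_mul_one_add_four_mul_X_pow,
        show ((n : ℤ) - k).toNat = n - k by omega]
    · rw [if_pos (by omega), if_neg hkn]
  have h0 := hBP 0
  have h1 := hBP 1
  have h2 := hBP 2
  have h3 := hBP 3
  simp only [Nat.cast_zero, sub_zero, Nat.cast_one, Nat.cast_ofNat] at h0 h1 h2 h3
  rw [h0, h1, h2, h3, ← Polynomial.coeff_ofNat_mul, ← Polynomial.coeff_ofNat_mul,
    ← Polynomial.coeff_ofNat_mul, ← Polynomial.coeff_add, ← Polynomial.coeff_sub,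
    ← Polynomial.coeff_sub]
  congr 1
  rw [hP]
  ring
end

section
/- Define the integer sequence a : ℕ → ℕ by a(0) = 1, a(1) = 2, and for n ≥ 2, a(n) = 2·Σ_{k=0}^{n-1} a(k)·a(n-1-k) + a(n-1). Then a(n) is asymptotically equivalent, as n → ∞, to (3/(2·√2·√π)) · 9^n · n^{-3/2}. -/
open Filter Asymptotics Real

/-- If consecutive terms of `c` have ratio tending to `1`, then convolving `c` with a sequence `b`
decaying fast enough multiplies it asymptotically by `∑ b k`. -/
lemma tendsto_convolution_div {b c : ℕ → ℝ} {K : ℝ} (hc : ∀ n, c n ≠ 0)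
    (hK : ∀ n, |c n| ≤ K * |c (n + 1)|)
    (hratio : Tendsto (fun n => c n / c (n + 1)) atTop (nhds 1))
    (hb : Summable fun k => |b k| * K ^ k) :
    Tendsto (fun n => (∑ k ∈ Finset.range (n + 1), b k * c (n - k)) / c n) atTop
      (nhds (∑' k, b k)) := by
  have hK0 : 0 ≤ K := by
    by_contra! h
    have h1 := hK 0
    have h2 := abs_pos.2 (hc 0)
    have h3 := abs_pos.2 (hc 1)
    have h4 := mul_neg_of_neg_of_pos h h3
    simp only [zero_add] at h1
    linarith
  have hbound : ∀ k n, |c n| ≤ K ^ k * |c (n + k)| := by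
    intro k
    induction k with
    | zero => simp
    | succ k ih =>
      intro n
      calc |c n| ≤ K ^ k * |c (n + k)| := ih n
        _ ≤ K ^ k * (K * |c (n + k + 1)|) := by gcongr; exact hK _
        _ = K ^ (k + 1) * |c (n + (k + 1))| := by rw [pow_succ, mul_assoc, add_assoc]
  have hshift : ∀ k, Tendsto (fun n => c n / c (n + k)) atTop (nhds 1) := by
    intro k
    induction k with
    | zero => simp [div_self (hc _)]
    | succ k ih =>
      have h := ih.mul (hratio.comp (tendsto_add_atTop_nat k))
      rw [mul_one] at h
      refine h.congr fun n => ?_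
      have h1 := hc (n + k)
      have h2 := hc (n + k + 1)
      simp only [Function.comp_apply, ← add_assoc]
      field_simp
  have hterm : ∀ k, Tendsto (fun n => if k ≤ n then b k * (c (n - k) / c n) else 0) atTop
      (nhds (b k)) := by
    intro k
    rw [← tendsto_add_atTop_iff_nat k]
    simpa using (hshift k).const_mul (b k)
  have h := tendsto_tsum_of_dominated_convergence hb hterm (Eventually.of_forall fun n k => by
    split_ifs with hkn
    · have h1 := hbound k (n - k)
      rw [Nat.sub_add_cancel hkn] at h1
      rw [Real.norm_eq_abs, abs_mul, abs_div]
      gcongr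
      exact (div_le_iff₀ (abs_pos.2 (hc n))).2 h1
    · simp only [norm_zero]
      positivity)
  refine h.congr fun n => ?_
  rw [tsum_eq_sum (s := Finset.range (n + 1)), Finset.sum_div]
  · refine Finset.sum_congr rfl fun k hk => ?_
    rw [if_pos (Nat.lt_succ_iff.1 (Finset.mem_range.1 hk)), mul_div_assoc]
  · intro k hk
    rw [if_neg]
    simpa [Nat.lt_succ_iff] using hk

/-- The coefficient of `x ^ n` in `√(1 - x)`. -/
noncomputable def sqrtCoeff (n : ℕ) : ℝ :=
  (∏ j ∈ Finset.range n, (-1 / 2 + (j : ℝ))) / n.factorial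

lemma sqrtCoeff_zero : sqrtCoeff 0 = 1 := by simp [sqrtCoeff]

lemma sqrtCoeff_succ (n : ℕ) :
    sqrtCoeff (n + 1) = sqrtCoeff n * ((-1 / 2 + (n : ℝ)) / (n + 1)) := by
  have : (n.factorial : ℝ) ≠ 0 := by positivity
  rw [sqrtCoeff, sqrtCoeff, Finset.prod_range_succ, Nat.factorial_succ]
  push_cast
  field_simp

lemma natCast_sub_half_ne_zero (n : ℕ) : (-1 / 2 + (n : ℝ)) ≠ 0 := by
  intro h
  have h1 : ((2 * n : ℕ) : ℝ) = (1 : ℕ) := by push_cast; linarith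
  have h2 : 2 * n = 1 := by exact_mod_cast h1
  omega

lemma sqrtCoeff_ne_zero (n : ℕ) : sqrtCoeff n ≠ 0 := by
  induction n with
  | zero => simp [sqrtCoeff_zero]
  | succ n ih =>
    rw [sqrtCoeff_succ]
    exact mul_ne_zero ih (div_ne_zero (natCast_sub_half_ne_zero n) (by positivity))

lemma abs_sqrtCoeff_le (n : ℕ) : |sqrtCoeff n| ≤ 1 := by
  induction n with
  | zero => simp [sqrtCoeff_zero]
  | succ n ih =>
    rw [sqrtCoeff_succ, abs_mul]
    refine mul_le_one₀ ih (abs_nonneg _) ?_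
    have hn : (0 : ℝ) ≤ n := by positivity
    rw [abs_le, le_div_iff₀ (by positivity), div_le_iff₀ (by positivity)]
    constructor <;> linarith

lemma sqrtCoeff_div_succ (n : ℕ) :
    sqrtCoeff n / sqrtCoeff (n + 1) = ((n : ℝ) + 1) / (-1 / 2 + n) := by
  rw [sqrtCoeff_succ]
  have h1 := sqrtCoeff_ne_zero n
  have h2 := natCast_sub_half_ne_zero n
  rw [div_eq_div_iff (mul_ne_zero h1 (div_ne_zero h2 (by positivity))) h2]
  field_simp

lemma abs_sqrtCoeff_le_succ (n : ℕ) : |sqrtCoeff n| ≤ 4 * |sqrtCoeff (n + 1)| := by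
  rw [← div_le_iff₀ (abs_pos.2 (sqrtCoeff_ne_zero _)), ← abs_div, sqrtCoeff_div_succ]
  rcases n with _ | n
  · norm_num
  · have hn : (0 : ℝ) ≤ n := by positivity
    push_cast
    rw [abs_of_nonneg (div_nonneg (by linarith) (by linarith)), div_le_iff₀ (by linarith)]
    linarith

lemma tendsto_sqrtCoeff_div_succ :
    Tendsto (fun n => sqrtCoeff n / sqrtCoeff (n + 1)) atTop (nhds 1) := by
  simp_rw [sqrtCoeff_div_succ]
  simpa [add_comm] using
    tendsto_add_mul_div_add_mul_atTop_nhds (𝕜 := ℝ) 1 (-1 / 2) 1 one_ne_zero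

lemma tendsto_sqrtCoeff_mul_rpow :
    Tendsto (fun n : ℕ => sqrtCoeff n * (n : ℝ) ^ (3 / 2 : ℝ)) atTop
      (nhds (-1 / (2 * √π))) := by
  have hΓ : Real.Gamma (-1 / 2) = -(2 * √π) := by
    have h := Real.Gamma_add_one (s := -1 / 2) (by norm_num)
    norm_num [Real.Gamma_one_half_eq] at h
    linarith
  have hπ : 0 < √π := Real.sqrt_pos.2 Real.pi_pos
  have h1 := (Real.GammaSeq_tendsto_Gamma (-1 / 2)).inv₀ (by rw [hΓ]; linarith)
  have h2 : Tendsto (fun n : ℕ => (n : ℝ) / (-1 / 2 + n)) atTop (nhds 1) := by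
    simpa using tendsto_add_mul_div_add_mul_atTop_nhds (𝕜 := ℝ) 0 (-1 / 2) 1 one_ne_zero
  have h3 := h1.mul h2
  rw [hΓ, mul_one, show (-(2 * √π))⁻¹ = -1 / (2 * √π) by rw [inv_neg, neg_div, one_div]] at h3
  refine h3.congr' ?_
  filter_upwards [eventually_gt_atTop 0] with n hn
  have hn' : (0 : ℝ) < n := by exact_mod_cast hn
  have hf : (n.factorial : ℝ) ≠ 0 := by positivity
  have hpow : (n : ℝ) ^ (3 / 2 : ℝ) * (n : ℝ) ^ (-1 / 2 : ℝ) = n := by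
    rw [← Real.rpow_add hn']
    norm_num
  have h0 := natCast_sub_half_ne_zero n
  have hp : (n : ℝ) ^ (-1 / 2 : ℝ) ≠ 0 := (Real.rpow_pos_of_pos hn' _).ne'
  rw [Real.GammaSeq, sqrtCoeff, Finset.prod_range_succ, inv_div, div_mul_div_comm,
    div_mul_eq_mul_div, div_eq_div_iff (by positivity) (by positivity)]
  linear_combination (-(∏ j ∈ Finset.range n, (-1 / 2 + (j : ℝ))) * n.factorial *
    (-1 / 2 + (n : ℝ))) * hpow

open PowerSeries in
lemma mk_sqrtCoeff_sq : (mk sqrtCoeff) ^ 2 = 1 - X := by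
  have hC : 2 * ((1 - X) * d⁄dX ℝ (mk sqrtCoeff)) = -mk sqrtCoeff := by
    rw [← map_ofNat (C : ℝ →+* ℝ⟦X⟧) 2]
    ext n
    rw [sub_mul, one_mul, coeff_C_mul]
    rcases n with _ | n
    · rw [map_sub, coeff_zero_X_mul, coeff_derivative, map_neg, coeff_mk, coeff_mk,
        sqrtCoeff_succ, sqrtCoeff_zero]
      norm_num
    · rw [map_sub, coeff_succ_X_mul, coeff_derivative, coeff_derivative, map_neg, coeff_mk,
        coeff_mk, sqrtCoeff_succ (n + 1)]
      push_cast
      field_simp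
      ring
  have hE : (1 - X) * d⁄dX ℝ ((mk sqrtCoeff) ^ 2) = -(mk sqrtCoeff) ^ 2 := by
    rw [derivative_pow]
    push_cast
    linear_combination mk sqrtCoeff * hC
  generalize hEdef : (mk sqrtCoeff) ^ 2 = E at hE
  have hE0 : coeff 0 E = 1 := by simp [← hEdef, sqrtCoeff_zero]
  have hEsucc : ∀ n, coeff (n + 1) E * (n + 1) = (n - 1) * coeff n E := by
    intro n
    have h := congrArg (coeff n) hE
    rw [sub_mul, one_mul] at h
    rcases n with _ | n
    · rw [map_sub, coeff_zero_X_mul, coeff_derivative, map_neg] at h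
      push_cast at h ⊢
      linarith
    · rw [map_sub, coeff_succ_X_mul, coeff_derivative, coeff_derivative, map_neg] at h
      push_cast at h ⊢
      linarith
  have hE1 : coeff 1 E = -1 := by simpa [hE0] using hEsucc 0
  have hE2 : ∀ n, coeff (n + 2) E = 0 := by
    intro n
    induction n with
    | zero => simpa using hEsucc 1
    | succ n ih =>
      have h := hEsucc (n + 2)
      rw [ih, mul_zero] at h
      exact (mul_eq_zero.1 h).resolve_right (by positivity)
  ext n
  rcases n with _ | _ | n
  · simpa using hE0
  · simpa [coeff_one] using hE1
  · simpa [coeff_one, coeff_X] using hE2 n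

lemma summable_abs_sqrtCoeff_mul_pow {x : ℝ} (hx0 : 0 ≤ x) (hx1 : x < 1) :
    Summable fun k => |sqrtCoeff k| * x ^ k :=
  Summable.of_nonneg_of_le (fun k => by positivity)
    (fun k => mul_le_of_le_one_left (by positivity) (abs_sqrtCoeff_le k))
    (summable_geometric_of_lt_one hx0 hx1)

lemma tsum_sqrtCoeff_mul_pow {x : ℝ} (hx0 : 0 ≤ x) (hx1 : x ≤ 1 / 2) :
    ∑' k, sqrtCoeff k * x ^ k = √(1 - x) := by
  have hnorm : Summable fun k => ‖sqrtCoeff k * x ^ k‖ := by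
    simpa [abs_mul, abs_of_nonneg hx0] using
      summable_abs_sqrtCoeff_mul_pow hx0 (by linarith)
  have hsq : (∑' k, sqrtCoeff k * x ^ k) * ∑' k, sqrtCoeff k * x ^ k = 1 - x := by
    rw [tsum_mul_tsum_eq_tsum_sum_antidiagonal_of_summable_norm hnorm hnorm]
    have hcoeff : ∀ n, ∑ kl ∈ Finset.HasAntidiagonal.antidiagonal n,
        sqrtCoeff kl.1 * x ^ kl.1 * (sqrtCoeff kl.2 * x ^ kl.2) =
        PowerSeries.coeff n (1 - PowerSeries.X : PowerSeries ℝ) * x ^ n := by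
      intro n
      rw [← mk_sqrtCoeff_sq, sq, PowerSeries.coeff_mul, Finset.sum_mul]
      refine Finset.sum_congr rfl fun kl hkl => ?_
      rw [← Finset.HasAntidiagonal.mem_antidiagonal.1 hkl, PowerSeries.coeff_mk, PowerSeries.coeff_mk, pow_add]
      ring
    simp_rw [hcoeff]
    rw [tsum_eq_sum (s := Finset.range 2)]
    · simp [Finset.sum_range_succ, PowerSeries.coeff_one]
      ring
    · intro n hn
      have hn2 : 1 < n := by simpa using hn
      simp [PowerSeries.coeff_one, PowerSeries.coeff_X, show n ≠ 0 by omega,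
        show n ≠ 1 by omega]
  have hnonneg : 0 ≤ ∑' k, sqrtCoeff k * x ^ k := by
    have hgeom : Summable fun k => x ^ (k + 1) :=
      (summable_nat_add_iff 1).2 (summable_geometric_of_lt_one hx0 (by linarith))
    have hle : -∑' k, x ^ (k + 1) ≤ ∑' k, sqrtCoeff (k + 1) * x ^ (k + 1) := by
      rw [← tsum_neg]
      refine hgeom.neg.tsum_le_tsum (fun k => ?_) ((summable_nat_add_iff 1).2 hnorm.of_norm)
      have h1 := (abs_le.1 (abs_sqrtCoeff_le (k + 1))).1
      have h2 : 0 ≤ x ^ (k + 1) := by positivity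
      nlinarith
    have hsum : ∑' k, x ^ (k + 1) ≤ 1 := by
      simp_rw [pow_succ]
      rw [tsum_mul_right, tsum_geometric_of_lt_one hx0 (by linarith), inv_mul_le_iff₀] <;>
        linarith
    rw [hnorm.of_norm.tsum_eq_zero_add, sqrtCoeff_zero]
    simp only [pow_zero, mul_one]
    linarith
  rw [← hsq, Real.sqrt_mul_self hnonneg]

open PowerSeries in
/-- The generating function of `a` is `(1 - X - √(1 - X) √(1 - 9X)) / (4X)`. -/
lemma skew_dyck_generatingFunction (a : ℕ → ℕ) (ha0 : a 0 = 1) (ha1 : a 1 = 2)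
    (harec : ∀ n : ℕ, 2 ≤ n →
      a n = 2 * ∑ k ∈ Finset.range n, a k * a (n - 1 - k) + a (n - 1)) :
    1 - X - 4 * (X * mk fun n => (a n : ℝ)) = mk sqrtCoeff * rescale 9 (mk sqrtCoeff) := by
  set A : ℝ⟦X⟧ := mk fun n => (a n : ℝ) with hA
  have hquad : A = 1 - X + X * (A + C 2 * A ^ 2) := by
    ext n
    rcases n with _ | n
    · simp [hA, ha0]
    · rw [map_add, coeff_succ_X_mul, map_add, coeff_C_mul, sq, coeff_mul,
        Finset.Nat.sum_antidiagonal_eq_sum_range_succ fun i j => coeff i A * coeff j A]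
      simp only [hA, coeff_mk]
      rcases n with _ | n
      · simp [coeff_one, ha0, ha1]
      · rw [harec (n + 2) (by omega)]
        simp [coeff_one, coeff_X]
        ring
  have hC2 : (C 2 : ℝ⟦X⟧) = 2 := map_ofNat _ 2
  rw [hC2] at hquad
  have hres : (rescale 9 (mk sqrtCoeff)) ^ 2 = 1 - 9 * (X : ℝ⟦X⟧) := by
    rw [← map_pow, mk_sqrtCoeff_sq, map_sub, map_one, rescale_X,
      map_ofNat]
  have hsq : (1 - X - 4 * (X * A)) ^ 2 = (mk sqrtCoeff * rescale 9 (mk sqrtCoeff)) ^ 2 := by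
    rw [mul_pow, mk_sqrtCoeff_sq, hres]
    linear_combination (-8 * X) * hquad
  refine (sq_eq_sq_iff_eq_or_eq_neg.1 hsq).resolve_right fun h => ?_
  have h0 := congrArg constantCoeff h
  have hres0 : constantCoeff (rescale 9 (mk sqrtCoeff)) = 1 := by
    rw [← coeff_zero_eq_constantCoeff_apply, coeff_rescale]
    simp [sqrtCoeff_zero]
  simp [sqrtCoeff_zero, hres0] at h0
  norm_num at h0

lemma skew_dyck_eq_convolution (a : ℕ → ℕ) (ha0 : a 0 = 1) (ha1 : a 1 = 2)
    (harec : ∀ n : ℕ, 2 ≤ n →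
      a n = 2 * ∑ k ∈ Finset.range n, a k * a (n - 1 - k) + a (n - 1)) {n : ℕ} (hn : 0 < n) :
    (a n : ℝ) = -(9 ^ (n + 1) / 4) *
      ∑ k ∈ Finset.range (n + 1 + 1), sqrtCoeff k * (1 / 9) ^ k * sqrtCoeff (n + 1 - k) := by
  have h := congrArg (PowerSeries.coeff (n + 1)) (skew_dyck_generatingFunction a ha0 ha1 harec)
  rw [← map_ofNat (PowerSeries.C : ℝ →+* PowerSeries ℝ) 4, map_sub, map_sub,
    PowerSeries.coeff_C_mul, PowerSeries.coeff_succ_X_mul, PowerSeries.coeff_mul,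
    Finset.Nat.sum_antidiagonal_eq_sum_range_succ
      fun i j => PowerSeries.coeff i (PowerSeries.mk sqrtCoeff) *
        PowerSeries.coeff j (PowerSeries.rescale 9 (PowerSeries.mk sqrtCoeff))] at h
  simp only [PowerSeries.coeff_mk, PowerSeries.coeff_rescale, PowerSeries.coeff_one,
    PowerSeries.coeff_X, Nat.add_eq_zero_iff, hn.ne', Nat.add_eq_right, false_and, if_false] at h
  have hsum : ∑ k ∈ Finset.range (n + 1 + 1), sqrtCoeff k * (9 ^ (n + 1 - k) * sqrtCoeff (n + 1 - k))
      = 9 ^ (n + 1) *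
        ∑ k ∈ Finset.range (n + 1 + 1), sqrtCoeff k * (1 / 9) ^ k * sqrtCoeff (n + 1 - k) := by
    rw [Finset.mul_sum]
    refine Finset.sum_congr rfl fun k hk => ?_
    have hk' : k ≤ n + 1 := Nat.lt_succ_iff.1 (Finset.mem_range.1 hk)
    rw [pow_sub₀ _ (by norm_num) hk', one_div, inv_pow]
    ring
  rw [Nat.succ_eq_add_one, hsum] at h
  linarith

/-- The number `a(n)` of skew Dyck paths with two variants of down-steps of semilength `n`
is asymptotically `(3/(2√2 √π)) · 9^n · n^{-3/2}` as `n → ∞`. -/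
theorem skew_dyck_count_asymptotics (a : ℕ → ℕ)
    (ha0 : a 0 = 1) (ha1 : a 1 = 2)
    (harec : ∀ n : ℕ, 2 ≤ n →
      a n = 2 * ∑ k ∈ Finset.range n, a k * a (n - 1 - k) + a (n - 1)) :
    (fun n : ℕ => (a n : ℝ)) ~[atTop]
      (fun n : ℕ =>
        3 / (2 * Real.sqrt 2 * Real.sqrt π) * 9 ^ n * (n : ℝ) ^ (-(3 : ℝ) / 2)) := by
  have hπ : 0 < √π := Real.sqrt_pos.2 Real.pi_pos
  have hb : Summable fun k => |sqrtCoeff k * (1 / 9) ^ k| * 4 ^ k := by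
    refine (summable_abs_sqrtCoeff_mul_pow (x := 4 / 9) (by norm_num) (by norm_num)).congr
      fun k => ?_
    rw [abs_mul, abs_of_nonneg (a := (1 / 9 : ℝ) ^ k) (by positivity), mul_assoc, ← mul_pow]
    norm_num
  have hconv := (tendsto_add_atTop_iff_nat 1).2 (tendsto_convolution_div sqrtCoeff_ne_zero
    abs_sqrtCoeff_le_succ tendsto_sqrtCoeff_div_succ hb)
  rw [tsum_sqrtCoeff_mul_pow (by norm_num) (by norm_num)] at hconv
  have hlim := ((hconv.div tendsto_sqrtCoeff_div_succ one_ne_zero).mul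
    tendsto_sqrtCoeff_mul_rpow).const_mul (-(9 / 4 : ℝ) / (3 / (2 * √2 * √π)))
  have hconst : -(9 / 4 : ℝ) / (3 / (2 * √2 * √π)) * (√(1 - 1 / 9) / 1 * (-1 / (2 * √π))) = 1 := by
    have h8 : √(1 - 1 / 9 : ℝ) = 2 * √2 / 3 := by
      rw [Real.sqrt_eq_iff_mul_self_eq (by norm_num) (by positivity)]
      have := Real.mul_self_sqrt (show (0 : ℝ) ≤ 2 by norm_num)
      linear_combination (-4 / 9 : ℝ) * this
    have h2 : √(2 : ℝ) ^ 2 = 2 := Real.sq_sqrt (by norm_num)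
    rw [h8]
    field_simp
    rw [h2]
    norm_num
  rw [hconst] at hlim
  refine (isEquivalent_iff_tendsto_one ?_).2 (hlim.congr' ?_)
  · filter_upwards [eventually_gt_atTop 0] with n hn
    have hn' : (0 : ℝ) < n := by exact_mod_cast hn
    positivity
  · filter_upwards [eventually_gt_atTop 0] with n hn
    have hn' : (0 : ℝ) < n := by exact_mod_cast hn
    have hpow : (n : ℝ) ^ (-(3 : ℝ) / 2) = ((n : ℝ) ^ (3 / 2 : ℝ))⁻¹ := by
      rw [neg_div, Real.rpow_neg hn'.le]
    have hp : (n : ℝ) ^ (3 / 2 : ℝ) ≠ 0 := (Real.rpow_pos_of_pos hn' _).ne'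
    have hc := sqrtCoeff_ne_zero n
    have hc' := sqrtCoeff_ne_zero (n + 1)
    simp only [Pi.div_apply]
    rw [hpow, skew_dyck_eq_convolution a ha0 ha1 harec hn]
    generalize ∑ k ∈ Finset.range (n + 1 + 1),
      sqrtCoeff k * (1 / 9) ^ k * sqrtCoeff (n + 1 - k) = s
    rw [pow_succ]
    field_simp
end

section
/- Fix a real u with 0 < u < 1/2 and let z = u/((1+u)(1+4u)). Define for each natural number h the real numbers p_h = (-2u/(1-2u))·( (4u+3)u/((1+u)(1+4u)) )^h + (1/(1-2u))·( (3u+1)/((1+u)(1+4u)) )^h and q_h = (-4u²/(1-4u²))·( (4u+3)u/((1+u)(1+4u)) )^h + (1/(1-4u²))·( (3u+1)/((1+u)(1+4u)) )^h. Then p_0 = q_0 = 1 and for every h ≥ 1: p_h = (1-z)·q_{h-1} + z·p_{h-1} and q_h = q_{h-1} - 2z·p_{h-1}. -/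
/-- The explicit sequences `p_h`, `q_h` solve the coupled recurrences
`p_h = (1-z) q_{h-1} + z p_{h-1}`, `q_h = q_{h-1} - 2z p_{h-1}` with `p_0 = q_0 = 1`,
where `z = u/((1+u)(1+4u))` and `0 < u < 1/2`. -/
theorem skew_dyck_pq_recurrence (u : ℝ) (hu0 : 0 < u) (hu1 : u < 1 / 2)
    (z : ℝ) (hz : z = u / ((1 + u) * (1 + 4 * u)))
    (p q : ℕ → ℝ)
    (hp : ∀ h : ℕ, p h =
      (-2 * u / (1 - 2 * u)) * ((4 * u + 3) * u / ((1 + u) * (1 + 4 * u))) ^ h +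
      (1 / (1 - 2 * u)) * ((3 * u + 1) / ((1 + u) * (1 + 4 * u))) ^ h)
    (hq : ∀ h : ℕ, q h =
      (-4 * u ^ 2 / (1 - 4 * u ^ 2)) * ((4 * u + 3) * u / ((1 + u) * (1 + 4 * u))) ^ h +
      (1 / (1 - 4 * u ^ 2)) * ((3 * u + 1) / ((1 + u) * (1 + 4 * u))) ^ h) :
    p 0 = 1 ∧ q 0 = 1 ∧
    ∀ h : ℕ, 1 ≤ h →
      p h = (1 - z) * q (h - 1) + z * p (h - 1) ∧
      q h = q (h - 1) - 2 * z * p (h - 1) := by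
  have h₁ : 1 - 2 * u ≠ 0 := by linarith
  have h₂ : 1 + 2 * u ≠ 0 := by linarith
  have h₃ : 1 + u ≠ 0 := by linarith
  have h₄ : 1 + 4 * u ≠ 0 := by linarith
  have hfac : 1 - 4 * u ^ 2 = (1 - 2 * u) * (1 + 2 * u) := by ring
  rw [hfac] at hq
  refine ⟨?_, ?_, fun h hh ↦ ?_⟩
  · rw [hp]
    field_simp
    ring
  · rw [hq, pow_zero, pow_zero, mul_one, mul_one, ← add_div,
      div_eq_one_iff_eq (mul_ne_zero h₁ h₂)]
    ring
  · obtain ⟨k, rfl⟩ := Nat.exists_eq_add_of_le' hh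
    rw [Nat.add_sub_cancel, hp, hq, hp, hq, pow_succ, pow_succ, hz]
    generalize ((4 * u + 3) * u / ((1 + u) * (1 + 4 * u))) ^ k = a
    generalize ((3 * u + 1) / ((1 + u) * (1 + 4 * u))) ^ k = b
    constructor <;> field_simp <;> ring
end

section
/- Fix a real u with 0 < u < 1/2 and let z = u/((1+u)(1+4u)). Define for each natural number h the real number S_h = (1+2u)·( (3u+1)^h - 2u·u^h·(4u+3)^h ) / ( (3u+1)^h - 4u²·u^h·(4u+3)^h ). Then S_0 = 1, the denominator never vanishes, and for every h ≥ 1: S_h = (1 - z + z·S_{h-1})/(1 - 2z·S_{h-1}). -/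
/-- The denominator of the closed form is positive for `0 < u < 1/2`. -/
theorem skew_dyck_denominator_pos {u : ℝ} (hu0 : 0 < u) (hu1 : u < 1 / 2) (h : ℕ) :
    0 < (3 * u + 1) ^ h - 4 * u ^ 2 * u ^ h * (4 * u + 3) ^ h := by
  have hsq : 4 * u ^ 2 < 1 := by nlinarith
  have hpow : (u * (4 * u + 3)) ^ h ≤ (3 * u + 1) ^ h :=
    pow_le_pow_left₀ (by positivity) (by nlinarith) h
  have hpos : 0 < (u * (4 * u + 3)) ^ h := by positivity
  rw [mul_assoc, ← mul_pow]
  nlinarith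

/-- The closed form for the height-restricted generating function of skew Dyck paths with
two variants of down-steps: with `z = u/((1+u)(1+4u))` and `0 < u < 1/2`,
`S_h = (1+2u)((3u+1)^h - 2u·u^h(4u+3)^h)/((3u+1)^h - 4u²·u^h(4u+3)^h)` satisfies
`S_0 = 1`, the denominator never vanishes, and
`S_h = (1 - z + z S_{h-1})/(1 - 2z S_{h-1})` for `h ≥ 1`. -/
theorem skew_dyck_height_closed_form (u : ℝ) (hu0 : 0 < u) (hu1 : u < 1 / 2)
    (z : ℝ) (hz : z = u / ((1 + u) * (1 + 4 * u)))
    (S : ℕ → ℝ)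
    (hS : ∀ h : ℕ, S h =
      (1 + 2 * u) * ((3 * u + 1) ^ h - 2 * u * u ^ h * (4 * u + 3) ^ h) /
        ((3 * u + 1) ^ h - 4 * u ^ 2 * u ^ h * (4 * u + 3) ^ h)) :
    S 0 = 1 ∧
    (∀ h : ℕ, (3 * u + 1) ^ h - 4 * u ^ 2 * u ^ h * (4 * u + 3) ^ h ≠ 0) ∧
    ∀ h : ℕ, 1 ≤ h →
      S h = (1 - z + z * S (h - 1)) / (1 - 2 * z * S (h - 1)) := by
  have hD := skew_dyck_denominator_pos hu0 hu1
  refine ⟨?_, fun h => (hD h).ne', fun h hh => ?_⟩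
  · have h0 := hD 0
    rw [hS, div_eq_one_iff_eq h0.ne']
    ring
  · obtain ⟨k, rfl⟩ := Nat.exists_eq_add_of_le' hh
    rw [Nat.add_sub_cancel]
    have hk := hD k
    have hk1 := hD (k + 1)
    have hSk := hS k
    rw [hS (k + 1)]
    set D := (3 * u + 1) ^ k - 4 * u ^ 2 * u ^ k * (4 * u + 3) ^ k with hDdef
    have hP : 0 < (1 + u) * (1 + 4 * u) := by positivity
    have hzP : z * ((1 + u) * (1 + 4 * u)) = u := by rw [hz, div_mul_cancel₀ _ hP.ne']
    have hSD : S k * D = (1 + 2 * u) * ((3 * u + 1) ^ k - 2 * u * u ^ k * (4 * u + 3) ^ k) := by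
      rw [hSk, div_mul_cancel₀ _ hk.ne']
    have hden : (1 - 2 * z * S k) * ((1 + u) * (1 + 4 * u) * D) =
        (3 * u + 1) ^ (k + 1) - 4 * u ^ 2 * u ^ (k + 1) * (4 * u + 3) ^ (k + 1) := by
      linear_combination (-2 * S k * D) * hzP - 2 * u * hSD + ((1 + u) * (1 + 4 * u)) * hDdef
    have hnum : (1 - z + z * S k) * ((1 + u) * (1 + 4 * u) * D) =
        (1 + 2 * u) *
          ((3 * u + 1) ^ (k + 1) - 2 * u * u ^ (k + 1) * (4 * u + 3) ^ (k + 1)) := by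
      linear_combination (S k * D - D) * hzP + u * hSD + ((1 + u) * (1 + 4 * u) - u) * hDdef
    rw [← hden, ← hnum, mul_div_mul_right _ _ (mul_pos hP hk).ne']
end

section
/- Fix a real u with 0 < u < 1/2 and set λ = (4u+3)·u/(3u+1). Then 0 < λ < 1, and for every natural number h, (1 + 2u) - S_h = 2u·(1 - 4u²)·λ^h/(1 - 4u²·λ^h), where S_h = (1+2u)·( (3u+1)^h - 2u·u^h·(4u+3)^h ) / ( (3u+1)^h - 4u²·u^h·(4u+3)^h ). -/
/-- With `0 < u < 1/2` and `λ = (4u+3)u/(3u+1)`, we have `0 < λ < 1` and the generating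
function of paths of height exceeding `h` is
`(1+2u) - S_h = 2u(1-4u²) λ^h/(1 - 4u² λ^h)`. -/
theorem skew_dyck_excess_height (u : ℝ) (hu0 : 0 < u) (hu1 : u < 1 / 2)
    (lam : ℝ) (hlam : lam = (4 * u + 3) * u / (3 * u + 1))
    (S : ℕ → ℝ)
    (hS : ∀ h : ℕ, S h =
      (1 + 2 * u) * ((3 * u + 1) ^ h - 2 * u * u ^ h * (4 * u + 3) ^ h) /
        ((3 * u + 1) ^ h - 4 * u ^ 2 * u ^ h * (4 * u + 3) ^ h)) :
    0 < lam ∧ lam < 1 ∧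
    ∀ h : ℕ,
      (1 + 2 * u) - S h =
        2 * u * (1 - 4 * u ^ 2) * lam ^ h / (1 - 4 * u ^ 2 * lam ^ h) := by
  have hA : 0 < 3 * u + 1 := by linarith
  have hpos : 0 < lam := by rw [hlam]; positivity
  have hlt : lam < 1 := by
    rw [hlam, div_lt_one hA]
    nlinarith
  refine ⟨hpos, hlt, fun h => ?_⟩
  have hL : lam ^ h ≤ 1 := pow_le_one₀ hpos.le hlt.le
  have hden : 1 - 4 * u ^ 2 * lam ^ h ≠ 0 := by
    have hsq : 4 * u ^ 2 < 1 := by nlinarith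
    have hle : 4 * u ^ 2 * lam ^ h ≤ 4 * u ^ 2 := mul_le_of_le_one_right (by positivity) hL
    linarith
  have hApow : (3 * u + 1) ^ h ≠ 0 := (pow_pos hA h).ne'
  have hB : u ^ h * (4 * u + 3) ^ h = (3 * u + 1) ^ h * lam ^ h := by
    rw [← mul_pow, ← mul_pow, hlam, mul_div_cancel₀ _ hA.ne', mul_comm u]
  have hS' : S h = (1 + 2 * u) * (1 - 2 * u * lam ^ h) / (1 - 4 * u ^ 2 * lam ^ h) := by
    rw [← mul_div_mul_left _ (1 - 4 * u ^ 2 * lam ^ h) hApow, hS, mul_assoc (2 * u),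
      mul_assoc (4 * u ^ 2), hB]
    congr 1 <;> ring
  rw [hS', eq_div_iff hden, sub_mul, div_mul_cancel₀ _ hden]
  ring
end

section
/- Fix a real u with 0 < u < 1/2 and define S_h = (1+2u)·( (3u+1)^h - 2u·u^h·(4u+3)^h ) / ( (3u+1)^h - 4u²·u^h·(4u+3)^h ) for natural h. Then S_h → 1 + 2u as h → ∞. -/
open Filter

/-- The height-restricted generating function `S_h` tends to the unrestricted one
`1 + 2u` as `h → ∞`, for `0 < u < 1/2`. -/
theorem skew_dyck_height_limit (u : ℝ) (hu0 : 0 < u) (hu1 : u < 1 / 2)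
    (S : ℕ → ℝ)
    (hS : ∀ h : ℕ, S h =
      (1 + 2 * u) * ((3 * u + 1) ^ h - 2 * u * u ^ h * (4 * u + 3) ^ h) /
        ((3 * u + 1) ^ h - 4 * u ^ 2 * u ^ h * (4 * u + 3) ^ h)) :
    Tendsto S atTop (nhds (1 + 2 * u)) := by
  have hpos : 0 < 3 * u + 1 := by positivity
  set r : ℝ := u * (4 * u + 3) / (3 * u + 1) with hr
  have hr1 : r < 1 := by
    rw [hr, div_lt_one hpos]
    nlinarith
  have hlim : Tendsto (fun h : ℕ => r ^ h) atTop (nhds 0) :=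
    tendsto_pow_atTop_nhds_zero_of_lt_one (by positivity) hr1
  have hpow (h : ℕ) : u ^ h * (4 * u + 3) ^ h = (3 * u + 1) ^ h * r ^ h := by
    rw [← mul_pow, ← mul_pow, hr, mul_div_cancel₀ _ hpos.ne']
  have hS' : S = fun h => (1 + 2 * u) * (1 - 2 * u * r ^ h) / (1 - 4 * u ^ 2 * r ^ h) := by
    funext h
    rw [hS h, mul_assoc (2 * u), mul_assoc (4 * u ^ 2), hpow,
      ← mul_div_mul_left _ (1 - 4 * u ^ 2 * r ^ h) (pow_pos hpos h).ne']
    congr 1 <;> ring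
  rw [hS']
  have hnum := ((hlim.const_mul (2 * u)).const_sub 1).const_mul (1 + 2 * u)
  have hden := (hlim.const_mul (4 * u ^ 2)).const_sub 1
  simpa [Pi.div_def] using hnum.div hden (by simp)
end

section
/- Let u(z) be defined implicitly for 0 < z < 1/9 by u = (via the inverse of z = u/((1+u)(1+4u)) on (0,1/2)); equivalently, let u(z) ∈ (0,1/2) satisfy z·(1+u)(1+4u) = u. Then the limit as z → 1/9 from below of √(1 - 9z)/(1 - 2·u(z)) equals √2/3. -/
open Filter

/-- Completing the square: `1 - 9z` is a perfect square over `(1+u)(1+4u)`. -/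
theorem one_sub_two_mul_sq_eq {z u : ℝ} (h : z * (1 + u) * (1 + 4 * u) = u) :
    (1 - 2 * u) ^ 2 = (1 - 9 * z) * ((1 + u) * (1 + 4 * u)) := by
  linear_combination 9 * h

/-- In the variable `u`, the quotient `√(1 - 9z) / (1 - 2u)` has no singularity at `u = 1/2`. -/
theorem sqrt_one_sub_nine_mul_div_eq {z u : ℝ} (hu : u ∈ Set.Ioo (0 : ℝ) (1 / 2))
    (h : z * (1 + u) * (1 + 4 * u) = u) :
    √(1 - 9 * z) / (1 - 2 * u) = √((1 + u) * (1 + 4 * u))⁻¹ := by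
  obtain ⟨h0, h1⟩ := hu
  have hpos : 0 < 1 - 2 * u := by linarith
  have hD : 0 < (1 + u) * (1 + 4 * u) := by positivity
  have key : 1 - 9 * z = (1 - 2 * u) ^ 2 * ((1 + u) * (1 + 4 * u))⁻¹ := by
    rw [one_sub_two_mul_sq_eq h, mul_inv_cancel_right₀ hD.ne']
  rw [key, Real.sqrt_mul (sq_nonneg _), Real.sqrt_sq hpos.le, mul_div_cancel_left₀ _ hpos.ne']

/-- The inverse of the substitution tends to `1/2` at the singularity `z = 1/9`. -/
theorem tendsto_half_of_substitution {u : ℝ → ℝ}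
    (hu : ∀ z : ℝ, z ∈ Set.Ioo (0 : ℝ) (1 / 9) →
      u z ∈ Set.Ioo (0 : ℝ) (1 / 2) ∧ z * (1 + u z) * (1 + 4 * u z) = u z) :
    Tendsto u (nhdsWithin (1 / 9) (Set.Ioo (0 : ℝ) (1 / 9))) (nhds (1 / 2)) := by
  have hlower : Tendsto (fun z : ℝ => (1 - √((1 - 9 * z) * (9 / 2))) / 2)
      (nhdsWithin (1 / 9) (Set.Ioo (0 : ℝ) (1 / 9))) (nhds (1 / 2)) := by
    have hc : Continuous fun z : ℝ => (1 - √((1 - 9 * z) * (9 / 2))) / 2 := by fun_prop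
    have ht := hc.tendsto (1 / 9)
    norm_num at ht
    norm_num
    exact ht.mono_left nhdsWithin_le_nhds
  refine tendsto_of_tendsto_of_tendsto_of_le_of_le' hlower tendsto_const_nhds ?_ ?_
  · filter_upwards [self_mem_nhdsWithin] with z hz
    obtain ⟨⟨h0, h1⟩, h⟩ := hu z hz
    have hz1 : 0 < 1 - 9 * z := by linarith [hz.2]
    have hle : 1 - 2 * u z ≤ √((1 - 9 * z) * (9 / 2)) := by
      apply Real.le_sqrt_of_sq_le
      rw [one_sub_two_mul_sq_eq h]
      gcongr
      nlinarith
    linarith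
  · filter_upwards [self_mem_nhdsWithin] with z hz
    exact (hu z hz).1.2.le

/-- Let `u(z) ∈ (0,1/2)` be the inverse of the substitution `z = u/((1+u)(1+4u))`,
i.e. `z(1+u(z))(1+4u(z)) = u(z)` for `0 < z < 1/9`. Then
`√(1-9z)/(1-2u(z)) → √2/3` as `z → (1/9)⁻`. -/
theorem skew_dyck_substitution_singular (u : ℝ → ℝ)
    (hu : ∀ z : ℝ, z ∈ Set.Ioo (0 : ℝ) (1 / 9) →
      u z ∈ Set.Ioo (0 : ℝ) (1 / 2) ∧ z * (1 + u z) * (1 + 4 * u z) = u z) :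
    Tendsto (fun z : ℝ => Real.sqrt (1 - 9 * z) / (1 - 2 * u z))
      (nhdsWithin (1 / 9) (Set.Ioo (0 : ℝ) (1 / 9))) (nhds (Real.sqrt 2 / 3)) := by
  have hg : ContinuousAt (fun v : ℝ => √((1 + v) * (1 + 4 * v))⁻¹) (1 / 2) := by
    refine (ContinuousAt.inv₀ (by fun_prop) ?_).sqrt
    norm_num
  have hval : √((1 + 1 / 2) * (1 + 4 * (1 / 2)))⁻¹ = √2 / 3 := by
    rw [Real.sqrt_eq_iff_mul_self_eq (by norm_num) (by positivity), div_mul_div_comm,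
      Real.mul_self_sqrt (by norm_num)]
    norm_num
  have hlim := hg.tendsto.comp (tendsto_half_of_substitution hu)
  rw [hval] at hlim
  refine hlim.congr' ?_
  filter_upwards [self_mem_nhdsWithin] with z hz
  exact (sqrt_one_sub_nine_mul_div_eq (hu z hz).1 (hu z hz).2).symm
end

section
/- Let z be a real number with 0 < z < 1/3 and set μ₁ = (1 + z² + √(1 - 10z² + 9z⁴))/(2z). For each natural number i define f_i = μ₁^{-i}, g_i = 1/(z·μ₁^{i+1}) - μ₁^{-i}, h_i = -(1/2)·μ₁^{-i} - (z - 1/(2z))·μ₁^{-(i+1)}. Then f_0 = 1 and for every i ≥ 0: f_{i+1} = z·f_i + z·g_i, g_i = 2z·f_{i+1} + 2z·g_{i+1} + 2z·h_{i+1}, and h_i = z·g_{i+1} + z·h_{i+1}. -/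
/-- The closed forms `f_i = μ₁^{-i}`, `g_i = 1/(z μ₁^{i+1}) - μ₁^{-i}`,
`h_i = -(1/2) μ₁^{-i} - (z - 1/(2z)) μ₁^{-(i+1)}` solve the automaton recursions
`f_0 = 1`, `f_{i+1} = z f_i + z g_i`, `g_i = 2z f_{i+1} + 2z g_{i+1} + 2z h_{i+1}`,
`h_i = z g_{i+1} + z h_{i+1}` for skew Dyck paths with two variants of down-steps. -/
theorem skew_dyck_level_gfs (z : ℝ) (hz0 : 0 < z) (hz1 : z < 1 / 3)
    (mu1 : ℝ)
    (hmu1 : mu1 = (1 + z ^ 2 + Real.sqrt (1 - 10 * z ^ 2 + 9 * z ^ 4)) / (2 * z))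
    (f g h : ℕ → ℝ)
    (hf : ∀ i : ℕ, f i = 1 / mu1 ^ i)
    (hg : ∀ i : ℕ, g i = 1 / (z * mu1 ^ (i + 1)) - 1 / mu1 ^ i)
    (hh : ∀ i : ℕ, h i = -(1 / 2) * (1 / mu1 ^ i) - (z - 1 / (2 * z)) * (1 / mu1 ^ (i + 1))) :
    f 0 = 1 ∧
    (∀ i : ℕ, f (i + 1) = z * f i + z * g i) ∧
    (∀ i : ℕ, g i = 2 * z * f (i + 1) + 2 * z * g (i + 1) + 2 * z * h (i + 1)) ∧
    (∀ i : ℕ, h i = z * g (i + 1) + z * h (i + 1)) := by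
  have hz : z ≠ 0 := hz0.ne'
  have hmu : mu1 ≠ 0 := by
    rw [hmu1]
    positivity
  have hdisc : 0 ≤ 1 - 10 * z ^ 2 + 9 * z ^ 4 := by
    have h9 : 9 * z ^ 2 < 1 := by nlinarith
    nlinarith [mul_nonneg (by nlinarith : (0 : ℝ) ≤ 1 - z ^ 2) (sub_nonneg.2 h9.le)]
  have hkernel : z * mu1 ^ 2 - (1 + z ^ 2) * mu1 + 3 * z - 2 * z ^ 3 = 0 := by
    have hsq := Real.sq_sqrt hdisc
    rw [hmu1]
    generalize √(1 - 10 * z ^ 2 + 9 * z ^ 4) = s at hsq ⊢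
    field_simp
    linear_combination hsq
  refine ⟨by simp [hf], fun i => ?_, fun i => ?_, fun i => ?_⟩
  · rw [hf, hf, hg]
    field_simp
    ring
  · rw [hf, hg, hg, hh]
    simp only [pow_succ]
    field_simp
    linear_combination -hkernel
  · rw [hg, hh, hh]
    simp only [pow_succ]
    field_simp
    linear_combination -hkernel
end

section
/- Let z be a real number with 0 < z < 1/3, let K ≥ 1, and let D_j denote the determinant of the j×j tridiagonal matrix with diagonal -(1+z²), superdiagonal z(3-2z²), subdiagonal z (so D_0 = 1, D_1 = -(1+z²), D_j = -(1+z²)D_{j-1} - z²(3-2z²)D_{j-2}). Suppose the vector (g_0, g_1, …, g_K) ∈ ℝ^{K+1} satisfies: (2-3z²)·g_0 + z(3-2z²)·g_1 = 2(1-z²)/z; z·g_{i-1} - (1+z²)·g_i + z(3-2z²)·g_{i+1} = 0 for 1 ≤ i ≤ K-1; and z·g_{K-1} - (1+z²)·g_K = 0. If (2-3z²)·D_K - z²·(3-2z²)·D_{K-1} ≠ 0, then g_0 = (2(1-z²)/z)·D_K / ((2-3z²)·D_K - z²·(3-2z²)·D_{K-1}). -/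
/-- Backward elimination in a tridiagonal system with constant diagonal `-a`, superdiagonal `b` and
subdiagonal `c`: consecutive unknowns are related through consecutive continuants `D j`. -/
theorem tridiagonal_backward_elimination {R : Type*} [CommRing R] {a b c : R} {K : ℕ}
    {D g : ℕ → R} (hD0 : D 0 = 1) (hD1 : D 1 = -a)
    (hD : ∀ j, D (j + 2) = -a * D (j + 1) - c * b * D j)
    (hg : ∀ i, i + 2 ≤ K → c * g i - a * g (i + 1) + b * g (i + 2) = 0)
    (hgK : ∀ i, i + 1 = K → c * g i - a * g (i + 1) = 0) (j i : ℕ) (hij : j + i + 1 = K) :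
    D (j + 1) * g (i + 1) + c * D j * g i = 0 := by
  induction j generalizing i with
  | zero =>
    rw [zero_add, hD0, hD1]
    linear_combination hgK i (by lia)
  | succ j ih =>
    rw [hD]
    linear_combination D (j + 1) * hg i (by lia) - b * ih (i + 1) (by lia)


/-- Cramer's-rule evaluation of the first unknown of the truncated linear system for the
level generating functions `g_i` of skew Dyck paths with two variants of down-steps:
if `(g_0, …, g_K)` satisfies the boundary equation `(2-3z²) g_0 + z(3-2z²) g_1 = 2(1-z²)/z`,
the interior equations `z g_{i-1} - (1+z²) g_i + z(3-2z²) g_{i+1} = 0` for `1 ≤ i ≤ K-1`,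
and the final equation `z g_{K-1} - (1+z²) g_K = 0`, and if the denominator
`(2-3z²) D_K - z²(3-2z²) D_{K-1}` is nonzero, then
`g_0 = (2(1-z²)/z) D_K / ((2-3z²) D_K - z²(3-2z²) D_{K-1})`, where `D_j` is the
tridiagonal determinant sequence `D_0 = 1`, `D_1 = -(1+z²)`,
`D_j = -(1+z²) D_{j-1} - z²(3-2z²) D_{j-2}`. -/
theorem skew_dyck_cramer_g0 (z : ℝ) (hz0 : 0 < z) (hz1 : z < 1 / 3)
    (K : ℕ) (hK : 1 ≤ K)
    (D : ℕ → ℝ)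
    (hD0 : D 0 = 1) (hD1 : D 1 = -(1 + z ^ 2))
    (hDrec : ∀ j : ℕ, 2 ≤ j →
      D j = -(1 + z ^ 2) * D (j - 1) - z ^ 2 * (3 - 2 * z ^ 2) * D (j - 2))
    (g : ℕ → ℝ)
    (hg0 : (2 - 3 * z ^ 2) * g 0 + z * (3 - 2 * z ^ 2) * g 1 = 2 * (1 - z ^ 2) / z)
    (hgi : ∀ i : ℕ, 1 ≤ i → i ≤ K - 1 →
      z * g (i - 1) - (1 + z ^ 2) * g i + z * (3 - 2 * z ^ 2) * g (i + 1) = 0)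
    (hgK : z * g (K - 1) - (1 + z ^ 2) * g K = 0)
    (hne : (2 - 3 * z ^ 2) * D K - z ^ 2 * (3 - 2 * z ^ 2) * D (K - 1) ≠ 0) :
    g 0 = (2 * (1 - z ^ 2) / z) * D K /
      ((2 - 3 * z ^ 2) * D K - z ^ 2 * (3 - 2 * z ^ 2) * D (K - 1)) := by
  obtain ⟨k, rfl⟩ : ∃ k, K = k + 1 := ⟨K - 1, by lia⟩
  have elim : D (k + 1) * g 1 + z * D k * g 0 = 0 := by
    refine tridiagonal_backward_elimination (a := 1 + z ^ 2) (b := z * (3 - 2 * z ^ 2))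
      (K := k + 1) hD0 hD1 (fun j => ?_) (fun i hi => hgi (i + 1) (by lia) (by lia))
      (fun i hi => ?_) k 0 rfl
    · have := hDrec (j + 2) (by lia)
      simp only [Nat.add_sub_cancel, show j + 2 - 1 = j + 1 from rfl] at this
      linear_combination this
    · obtain rfl : i = k := by lia
      exact hgK
  rw [Nat.add_sub_cancel] at hne ⊢
  rw [eq_div_iff hne, ← hg0]
  linear_combination -(z * (3 - 2 * z ^ 2)) * elim
end
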